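/- If b < -1/4, then the quadratic form Q(u) = ∫₀^∞ (|u'(r)|² + (b/r²)|u(r)|²) dr is unbounded from below on C₀^∞(0,∞): for every M ∈ ℝ there exists u ∈ C₀^∞(0,∞) with ‖u‖_{L²} = 1 and Q(u) < -M. -/

import Mathlib

open MeasureTheory Set

lemma integral_Ioi_zero_eq_integral_exp (f : ℝ → ℝ) :
    ∫ r in Ioi (0 : ℝ), f r = ∫ x, Real.exp x * f (Real.exp x) := by
  have h := integral_image_eq_integral_abs_deriv_smul (s := univ) (f := Real.exp)
    (f' := Real.exp) MeasurableSet.univ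
    (fun x _ => (Real.hasDerivAt_exp x).hasDerivWithinAt) Real.exp_injective.injOn f
  rw [image_univ, Real.range_exp] at h
  simpa [abs_of_pos (Real.exp_pos _)] using h

/-- The function `√r φ(ε log r)`, which is almost an optimizer of the Hardy inequality. -/
noncomputable def hardyTrial (φ : ℝ → ℝ) (ε r : ℝ) : ℝ := √r * φ (ε * Real.log r)

section hardyTrial

variable {φ : ℝ → ℝ} {ε : ℝ}

lemma exists_tsupport_hardyTrial_subset (hφ : HasCompactSupport φ) (hε : 0 < ε) :
    ∃ a b : ℝ, 0 < a ∧ tsupport (hardyTrial φ ε) ⊆ Icc a b := by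
  obtain ⟨R, hR⟩ := hφ.isCompact.isBounded.subset_closedBall 0
  refine ⟨Real.exp (-R / ε), Real.exp (R / ε), Real.exp_pos _,
    closure_minimal (fun r hr => ?_) isClosed_Icc⟩
  rw [Function.mem_support, hardyTrial, mul_ne_zero_iff] at hr
  have hr0 : 0 < r := by
    by_contra! h
    exact hr.1 (Real.sqrt_eq_zero_of_nonpos h)
  have hmem := hR (subset_tsupport φ hr.2)
  rw [mem_closedBall_zero_iff, Real.norm_eq_abs, abs_le] at hmem
  constructor
  · rw [← Real.le_log_iff_exp_le hr0, div_le_iff₀ hε]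
    linarith
  · rw [← Real.log_le_iff_le_exp hr0, le_div_iff₀ hε]
    linarith

lemma contDiff_hardyTrial (hc : HasCompactSupport φ) (hφ : ContDiff ℝ (⊤ : ℕ∞) φ) (hε : 0 < ε) :
    ContDiff ℝ (⊤ : ℕ∞) (hardyTrial φ ε) := by
  obtain ⟨a, b, ha, hab⟩ := exists_tsupport_hardyTrial_subset hc hε
  refine contDiff_iff_contDiffAt.2 fun r => ?_
  by_cases hr : r ∈ tsupport (hardyTrial φ ε)
  swap
  · exact contDiffAt_const.congr_of_eventuallyEq (notMem_tsupport_iff_eventuallyEq.1 hr)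
  have hr0 : r ≠ 0 := (ha.trans_le (hab hr).1).ne'
  exact (Real.contDiffAt_sqrt hr0).mul
    (hφ.contDiffAt.comp r (contDiffAt_const.mul (Real.contDiffAt_log.2 hr0)))

lemma deriv_hardyTrial_exp (hφ : Differentiable ℝ φ) (x : ℝ) :
    deriv (hardyTrial φ ε) (Real.exp x) =
      (√(Real.exp x))⁻¹ * (φ (ε * x) / 2 + ε * deriv φ (ε * x)) := by
  have hx := Real.exp_pos x
  have hlog : HasDerivAt (fun r => ε * Real.log r) (ε * (Real.exp x)⁻¹) (Real.exp x) :=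
    (Real.hasDerivAt_log hx.ne').const_mul ε
  have hcomp : HasDerivAt (fun r => φ (ε * Real.log r))
      (deriv φ (ε * Real.log (Real.exp x)) * (ε * (Real.exp x)⁻¹)) (Real.exp x) :=
    (hφ _).hasDerivAt.comp _ hlog
  have h := (Real.hasDerivAt_sqrt hx.ne').mul hcomp
  rw [Real.log_exp] at h
  refine (HasDerivAt.deriv h).trans ?_
  have hs : 0 < √(Real.exp x) := Real.sqrt_pos.2 hx
  have hsq : √(Real.exp x) ^ 2 = Real.exp x := Real.sq_sqrt hx.le
  set s := √(Real.exp x)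
  rw [← hsq]
  field_simp

lemma hardyForm_hardyTrial (hc : HasCompactSupport φ) (hφ : ContDiff ℝ (⊤ : ℕ∞) φ) (hε : 0 < ε)
    (b : ℝ) :
    ∫ r in Ioi (0 : ℝ), (deriv (hardyTrial φ ε) r ^ 2 + b / r ^ 2 * hardyTrial φ ε r ^ 2) =
      ε⁻¹ * ((1 / 4 + b) * (∫ y, φ y ^ 2) + ε * (∫ y, φ y * deriv φ y)
        + ε ^ 2 * ∫ y, deriv φ y ^ 2) := by
  have hd : Continuous (deriv φ) := hφ.continuous_deriv (by simp)
  have hcd : HasCompactSupport (deriv φ) := hc.deriv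
  have h1 : Integrable fun y => φ y ^ 2 := by
    simp only [pow_two]
    exact (hφ.continuous.mul hφ.continuous).integrable_of_hasCompactSupport hc.mul_right
  have h2 : Integrable fun y => φ y * deriv φ y :=
    (hφ.continuous.mul hd).integrable_of_hasCompactSupport hc.mul_right
  have h3 : Integrable fun y => deriv φ y ^ 2 := by
    simp only [pow_two]
    exact (hd.mul hd).integrable_of_hasCompactSupport hcd.mul_right
  have h12 : Integrable fun y => (1 / 4 + b) * φ y ^ 2 + ε * (φ y * deriv φ y) :=
    (h1.const_mul _).add (h2.const_mul _)
  rw [integral_Ioi_zero_eq_integral_exp]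
  have key (x : ℝ) : Real.exp x * (deriv (hardyTrial φ ε) (Real.exp x) ^ 2 +
      b / Real.exp x ^ 2 * hardyTrial φ ε (Real.exp x) ^ 2) =
      (fun y => (1 / 4 + b) * φ y ^ 2 + ε * (φ y * deriv φ y) + ε ^ 2 * deriv φ y ^ 2)
        (ε * x) := by
    have hx := Real.exp_pos x
    rw [deriv_hardyTrial_exp (hφ.differentiable (by simp)), hardyTrial, Real.log_exp, mul_pow,
      mul_pow, inv_pow, Real.sq_sqrt hx.le]
    field_simp
    ring
  simp_rw [key]
  rw [Measure.integral_comp_mul_left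
    (fun y => (1 / 4 + b) * φ y ^ 2 + ε * (φ y * deriv φ y) + ε ^ 2 * deriv φ y ^ 2),
    abs_of_pos (inv_pos.2 hε), smul_eq_mul,
    integral_add h12 (h3.const_mul _),
    integral_add (h1.const_mul _) (h2.const_mul _)]
  simp only [integral_const_mul]

end hardyTrial

lemma exists_hardyForm_neg {b : ℝ} (hb : b < -(1 / 4 : ℝ)) :
    ∃ v : ℝ → ℝ, ContDiff ℝ (⊤ : ℕ∞) v ∧ HasCompactSupport v ∧ tsupport v ⊆ Ioi 0 ∧
      0 < (∫ r in Ioi (0 : ℝ), v r ^ 2) ∧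
      (∫ r in Ioi (0 : ℝ), (deriv v r ^ 2 + b / r ^ 2 * v r ^ 2)) < 0 := by
  let φ : ContDiffBump (0 : ℝ) := ⟨1, 2, one_pos, one_lt_two⟩
  have hφ : ContDiff ℝ (⊤ : ℕ∞) φ := φ.contDiff
  have hc : HasCompactSupport φ := φ.hasCompactSupport
  have hφ0 : φ 0 = 1 := φ.one_of_mem_closedBall (by simp [φ])
  have pos_sq {f : ℝ → ℝ} (hf : Continuous f) (hfc : HasCompactSupport f) {x : ℝ}
      (hx : f x ≠ 0) : 0 < ∫ y, f y ^ 2 := by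
    refine (hf.pow 2).integral_pos_of_hasCompactSupport_nonneg_nonzero ?_
      (fun y => sq_nonneg (f y)) (pow_ne_zero 2 hx)
    simpa only [pow_two] using hfc.mul_right
  have hA : (1 / 4 + b) * (∫ y, φ y ^ 2) < 0 :=
    mul_neg_of_neg_of_pos (by linarith) (pos_sq hφ.continuous hc (x := 0) (by simp [hφ0]))
  obtain ⟨ε, hneg, hε⟩ : ∃ ε : ℝ, (1 / 4 + b) * (∫ y, φ y ^ 2) +
      ε * (∫ y, φ y * deriv φ y) + ε ^ 2 * (∫ y, deriv φ y ^ 2) < 0 ∧ 0 < ε := by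
    have hcont : Continuous fun ε : ℝ => (1 / 4 + b) * (∫ y, φ y ^ 2) +
      ε * (∫ y, φ y * deriv φ y) + ε ^ 2 * (∫ y, deriv φ y ^ 2) := by fun_prop
    have hev := hcont.continuousAt.eventually_lt (x₀ := 0) continuousAt_const
      (by simpa using hA)
    exact ((hev.filter_mono nhdsWithin_le_nhds).and
      (self_mem_nhdsWithin (s := Ioi (0 : ℝ)))).exists
  obtain ⟨a, d, ha, hsub⟩ := exists_tsupport_hardyTrial_subset hc hε
  have hv := contDiff_hardyTrial hc hφ hε
  have hvc : HasCompactSupport (hardyTrial φ ε) :=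
    isCompact_Icc.of_isClosed_subset (isClosed_tsupport _) hsub
  refine ⟨hardyTrial φ ε, hv, hvc, fun r hr => ha.trans_le (hsub hr).1, ?_, ?_⟩
  · rw [setIntegral_eq_integral_of_forall_compl_eq_zero]
    · exact pos_sq hv.continuous hvc (x := 1) (by simp [hardyTrial, hφ0])
    · intro r hr
      simp [hardyTrial, Real.sqrt_eq_zero_of_nonpos (not_lt.1 hr)]
  · rw [hardyForm_hardyTrial hc hφ hε]
    exact mul_neg_of_pos_of_neg (inv_pos.2 hε) hneg

/-- For `b < -1/4`, the quadratic form is unbounded from below on `C₀^∞(0,∞)`: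
for every `M` there is a normalized `u` with `Q(u) < -M`. -/
theorem stmt1 (b : ℝ) (hb : b < -(1/4 : ℝ)) (M : ℝ) :
    ∃ u : ℝ → ℂ, ContDiff ℝ (⊤ : ℕ∞) u ∧ HasCompactSupport u ∧ tsupport u ⊆ Set.Ioi 0 ∧
      (∫ r in Set.Ioi (0:ℝ), ‖u r‖^2) = 1 ∧
      (∫ r in Set.Ioi (0:ℝ), (‖deriv u r‖^2 + (b / r^2) * ‖u r‖^2)) < -M := by
  obtain ⟨v, hv, hvc, hvs, hN, hQ⟩ := exists_hardyForm_neg hb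
  set N := ∫ r in Ioi (0 : ℝ), v r ^ 2
  set Q := ∫ r in Ioi (0 : ℝ), (deriv v r ^ 2 + b / r ^ 2 * v r ^ 2)
  obtain ⟨l, hl1, hlM⟩ : ∃ l : ℝ, 1 ≤ l ∧ M * N / (-Q) < l :=
    ⟨max 1 (M * N / (-Q) + 1), le_max_left _ _,
      (lt_add_one _).trans_le (le_max_right _ _)⟩
  have hl : 0 < l := one_pos.trans_le hl1
  set c := √(l / N)
  have hc2 : c ^ 2 = l / N := Real.sq_sqrt (by positivity)
  let w : ℝ → ℝ := fun r => c * v (l * r)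
  have hw : ContDiff ℝ (⊤ : ℕ∞) w := contDiff_const.mul (hv.comp (contDiff_const.mul contDiff_id))
  have hnorm (r : ℝ) : ‖(w r : ℂ)‖ ^ 2 = c ^ 2 * v (l * r) ^ 2 := by
    rw [Complex.norm_real, Real.norm_eq_abs, sq_abs, mul_pow]
  have hderiv (r : ℝ) : ‖deriv (fun r => (w r : ℂ)) r‖ ^ 2 =
      c ^ 2 * l ^ 2 * deriv v (l * r) ^ 2 := by
    have h1 : HasDerivAt (fun r => v (l * r)) (deriv v (l * r) * (l * 1)) r :=
      ((hv.differentiable (by simp)) _).hasDerivAt.comp r ((hasDerivAt_id r).const_mul l)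
    rw [(h1.const_mul c).ofReal_comp.deriv, Complex.norm_real, Real.norm_eq_abs, sq_abs]
    ring
  have hsupp : tsupport (fun r => (w r : ℂ)) ⊆ (fun r => l * r) ⁻¹' tsupport v := by
    refine closure_minimal (fun r hr => subset_tsupport v fun h => hr ?_)
      ((isClosed_tsupport v).preimage (by fun_prop))
    simp [w, h]
  have hcomp : IsCompact ((fun r => l * r) ⁻¹' tsupport v) :=
    (Homeomorph.mulLeft₀ l hl.ne').isCompact_preimage.2 hvc
  refine ⟨fun r => w r, Complex.ofRealCLM.contDiff.comp hw,
    hcomp.of_isClosed_subset (isClosed_tsupport _) hsupp,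
    fun r hr => pos_of_mul_pos_right (hvs (hsupp hr)) hl.le, ?_, ?_⟩
  · simp_rw [hnorm]
    rw [integral_const_mul, integral_comp_mul_left_Ioi (fun r => v r ^ 2) 0 hl, mul_zero,
      smul_eq_mul, hc2]
    change l / N * (l⁻¹ * N) = 1
    field_simp
  · have key (r : ℝ) : ‖deriv (fun r => (w r : ℂ)) r‖ ^ 2 + b / r ^ 2 * ‖(w r : ℂ)‖ ^ 2 =
        c ^ 2 * l ^ 2 * (fun r => deriv v r ^ 2 + b / r ^ 2 * v r ^ 2) (l * r) := by
      rw [hderiv, hnorm]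
      rcases eq_or_ne r 0 with rfl | hr
      · simp
      · field_simp
    simp_rw [key]
    rw [integral_const_mul,
      integral_comp_mul_left_Ioi (fun r => deriv v r ^ 2 + b / r ^ 2 * v r ^ 2) 0 hl,
      mul_zero, smul_eq_mul, hc2]
    change l / N * l ^ 2 * (l⁻¹ * Q) < -M
    have h1 : M * N < l * (-Q) := (div_lt_iff₀ (neg_pos.2 hQ)).1 hlM
    have h2 : l / N * l ^ 2 * (l⁻¹ * Q) = l ^ 2 * Q / N := by field_simp
    rw [h2, div_lt_iff₀ hN]
    nlinarith [mul_nonneg (mul_nonneg hl.le (sub_nonneg.2 hl1)) (neg_pos.2 hQ).le]
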